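/- Define E := {((L − R)(ξ), (1/2)((L⁻¹)* + (R⁻¹)*)(ψ(ξ))) : ξ ∈ g} ⊆ W ⊕ W* and F := {((L + R)(ξ), (1/2)((L⁻¹)* − (R⁻¹)*)(ψ(ξ))) : ξ ∈ g} ⊆ W ⊕ W*, where (L⁻¹)*, (R⁻¹)* : g* → W* are the duals of L⁻¹, R⁻¹ : W → g. Then E and F are Lagrangian subspaces of W ⊕ W* with respect to the canonical split bilinear form, and W ⊕ W* = E ⊕ F is a Lagrangian splitting. (E is the fiber of the Cartan–Dirac structure of (G, B) and F its canonical Lagrangian complement.) -/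

import Mathlib

/-- A subset `S` of `W ⊕ W*` is Lagrangian when it coincides with its own orthogonal
complement with respect to the canonical split symmetric bilinear form
`⟨(v,α),(w,β)⟩ = α w + β v`. -/
def IsLagrangian {K W : Type*} [Field K] [AddCommGroup W] [Module K W]
    (S : Set (W × Module.Dual K W)) : Prop :=
  ∀ y : W × Module.Dual K W, y ∈ S ↔ ∀ x ∈ S, x.2 y.1 + y.2 x.1 = 0

/-- The fiber `E` of the Cartan–Dirac structure:
`E = {((L−R)ξ, (1/2)((L⁻¹)* + (R⁻¹)*)(ψ ξ)) : ξ ∈ g}`. -/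
def cartanE {K g W : Type*} [Field K] [AddCommGroup g] [Module K g]
    [AddCommGroup W] [Module K W] (L R : g ≃ₗ[K] W) (ψ : g ≃ₗ[K] Module.Dual K g) :
    Set (W × Module.Dual K W) :=
  {p | ∃ ξ : g, p = (L ξ - R ξ,
    (2 : K)⁻¹ •
      ((L.symm : W →ₗ[K] g).dualMap (ψ ξ) + (R.symm : W →ₗ[K] g).dualMap (ψ ξ)))}

/-- The canonical Lagrangian complement `F` of the Cartan–Dirac fiber:
`F = {((L+R)ξ, (1/2)((L⁻¹)* − (R⁻¹)*)(ψ ξ)) : ξ ∈ g}`. -/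
def cartanF {K g W : Type*} [Field K] [AddCommGroup g] [Module K g]
    [AddCommGroup W] [Module K W] (L R : g ≃ₗ[K] W) (ψ : g ≃ₗ[K] Module.Dual K g) :
    Set (W × Module.Dual K W) :=
  {p | ∃ ξ : g, p = (L ξ + R ξ,
    (2 : K)⁻¹ •
      ((L.symm : W →ₗ[K] g).dualMap (ψ ξ) - (R.symm : W →ₗ[K] g).dualMap (ψ ξ)))}

section

variable {K W : Type*} [Field K] [AddCommGroup W] [Module K W]

/-- The canonical split symmetric bilinear form on `W ⊕ W*` is non-degenerate. -/
theorem eq_zero_of_forall_splitPairing_eq_zero {z : W × Module.Dual K W}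
    (h : ∀ x : W × Module.Dual K W, x.2 z.1 + z.2 x.1 = 0) : z = 0 := by
  refine Prod.ext ((Module.forall_dual_apply_eq_zero_iff K z.1).1 fun φ => ?_)
    (LinearMap.ext fun w => ?_)
  · simpa using h (0, φ)
  · simpa using h (w, 0)

/-- An element orthogonal to two subsets which together span `W ⊕ W*` vanishes. -/
theorem eq_zero_of_orthogonal_of_spanning {S T : Set (W × Module.Dual K W)}
    (hST : ∀ z, ∃ x ∈ S, ∃ y ∈ T, z = x + y) {z : W × Module.Dual K W}
    (hzS : ∀ x ∈ S, x.2 z.1 + z.2 x.1 = 0) (hzT : ∀ x ∈ T, x.2 z.1 + z.2 x.1 = 0) :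
    z = 0 := by
  refine eq_zero_of_forall_splitPairing_eq_zero fun u => ?_
  obtain ⟨x, hx, y, hy, rfl⟩ := hST u
  simp only [Prod.fst_add, Prod.snd_add, LinearMap.add_apply, map_add]
  linear_combination hzS x hx + hzT y hy

/-- Of two isotropic subsets which together span `W ⊕ W*`, the first is Lagrangian. -/
theorem isLagrangian_of_isotropic_of_spanning {S T : Set (W × Module.Dual K W)}
    (hS : ∀ x ∈ S, ∀ y ∈ S, x.2 y.1 + y.2 x.1 = 0)
    (hT : ∀ x ∈ T, ∀ y ∈ T, x.2 y.1 + y.2 x.1 = 0)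
    (hST : ∀ z, ∃ x ∈ S, ∃ y ∈ T, z = x + y) : IsLagrangian S := by
  refine fun z => ⟨fun hz x hx => hS x hx z hz, fun hz => ?_⟩
  obtain ⟨s, hs, t, ht, rfl⟩ := hST z
  have ht0 : t = 0 := by
    refine eq_zero_of_orthogonal_of_spanning hST (fun x hx => ?_) fun x hx => hT x hx t ht
    have h := hz x hx
    simp only [Prod.fst_add, Prod.snd_add, LinearMap.add_apply, map_add] at h
    linear_combination h - hS x hx s hs
  simpa [ht0] using hs

variable {g : Type*} [AddCommGroup g] [Module K g] {L R : g ≃ₗ[K] W}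
  {ψ : g ≃ₗ[K] Module.Dual K g}

/-- If `A = L⁻¹ ∘ R` is orthogonal, then its inverse is its adjoint. -/
theorem apply_symm_eq_of_orthogonal
    (horth : ∀ ξ η : g, ψ (L.symm (R ξ)) (L.symm (R η)) = ψ ξ η) (ξ : g) (w : W) :
    ψ ξ (R.symm w) = ψ (L.symm (R ξ)) (L.symm w) := by
  simpa using (horth ξ (R.symm w)).symm

theorem cartanE_isotropic (hψsym : ∀ x y : g, ψ x y = ψ y x)
    (horth : ∀ ξ η : g, ψ (L.symm (R ξ)) (L.symm (R η)) = ψ ξ η) :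
    ∀ x ∈ cartanE L R ψ, ∀ y ∈ cartanE L R ψ, x.2 y.1 + y.2 x.1 = 0 := by
  rintro _ ⟨ξ, rfl⟩ _ ⟨η, rfl⟩
  simp only [LinearMap.smul_apply, LinearMap.add_apply, LinearMap.dualMap_apply,
    LinearEquiv.coe_coe, map_sub, LinearEquiv.symm_apply_apply, smul_eq_mul,
    apply_symm_eq_of_orthogonal horth _ (L _)]
  rw [hψsym (L.symm (R ξ)) η, hψsym (L.symm (R η)) ξ]
  ring

theorem cartanF_isotropic (hψsym : ∀ x y : g, ψ x y = ψ y x)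
    (horth : ∀ ξ η : g, ψ (L.symm (R ξ)) (L.symm (R η)) = ψ ξ η) :
    ∀ x ∈ cartanF L R ψ, ∀ y ∈ cartanF L R ψ, x.2 y.1 + y.2 x.1 = 0 := by
  rintro _ ⟨ξ, rfl⟩ _ ⟨η, rfl⟩
  simp only [LinearMap.smul_apply, LinearMap.sub_apply, LinearMap.dualMap_apply,
    LinearEquiv.coe_coe, map_add, LinearEquiv.symm_apply_apply, smul_eq_mul,
    apply_symm_eq_of_orthogonal horth _ (L _)]
  rw [hψsym (L.symm (R ξ)) η, hψsym (L.symm (R η)) ξ]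
  ring

theorem cartanE_add_cartanF_spanning [CharZero K]
    (horth : ∀ ξ η : g, ψ (L.symm (R ξ)) (L.symm (R η)) = ψ ξ η)
    (z : W × Module.Dual K W) :
    ∃ x ∈ cartanE L R ψ, ∃ y ∈ cartanF L R ψ, z = x + y := by
  obtain ⟨v, β⟩ := z
  obtain ⟨c, hc⟩ := ψ.surjective ((L : g →ₗ[K] W).dualMap β)
  have hβ (w : W) : ψ c (L.symm w) = β w := by simp [hc]
  set s : g := (2 : K)⁻¹ • L.symm v + c with hs
  set d : g := R.symm (L (c - (2 : K)⁻¹ • L.symm v)) with hd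
  refine ⟨_, ⟨(2 : K)⁻¹ • (s + d), rfl⟩, _, ⟨(2 : K)⁻¹ • (s - d), rfl⟩, ?_⟩
  refine Prod.ext ?_ (LinearMap.ext fun w => ?_)
  · have hRd : R d = L c - (2 : K)⁻¹ • v := by simp [hd]
    have hLs : L s = (2 : K)⁻¹ • v + L c := by simp [hs]
    simp only [Prod.mk_add_mk, map_smul, map_add, map_sub, hRd, hLs]
    module
  · have hdw : ψ d (R.symm w) = β w - (2 : K)⁻¹ * ψ (L.symm v) (L.symm w) := by
      rw [apply_symm_eq_of_orthogonal horth]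
      simp [hd, hβ]
    have hsw : ψ s (L.symm w) = (2 : K)⁻¹ * ψ (L.symm v) (L.symm w) + β w := by
      simp [hs, hβ]
    simp only [Prod.mk_add_mk, map_smul, map_add, map_sub, LinearMap.smul_apply,
      LinearMap.add_apply, LinearMap.sub_apply, LinearMap.dualMap_apply,
      LinearEquiv.coe_coe, smul_eq_mul, hdw, hsw]
    ring

end

/-- `E` and `F` are Lagrangian subspaces of `W ⊕ W*`, and
`W ⊕ W* = E ⊕ F` is a Lagrangian splitting. -/
theorem statement18 (K g W : Type*) [Field K] [CharZero K]
    [AddCommGroup g] [Module K g] [FiniteDimensional K g]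
    [AddCommGroup W] [Module K W] [FiniteDimensional K W]
    (L R : g ≃ₗ[K] W)
    (ψ : g ≃ₗ[K] Module.Dual K g) (hψsym : ∀ x y : g, ψ x y = ψ y x)
    (horth : ∀ ξ η : g, ψ (L.symm (R ξ)) (L.symm (R η)) = ψ ξ η) :
    IsLagrangian (cartanE L R ψ) ∧
    IsLagrangian (cartanF L R ψ) ∧
    cartanE L R ψ ∩ cartanF L R ψ = {0} ∧
    (∀ z : W × Module.Dual K W,
      ∃ x ∈ cartanE L R ψ, ∃ y ∈ cartanF L R ψ, z = x + y) := by
  have hE := cartanE_isotropic hψsym horth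
  have hF := cartanF_isotropic hψsym horth
  have hEF := cartanE_add_cartanF_spanning horth
  refine ⟨isLagrangian_of_isotropic_of_spanning hE hF hEF,
    isLagrangian_of_isotropic_of_spanning hF hE fun z => ?_,
    Set.eq_singleton_iff_unique_mem.2 ⟨⟨⟨0, by ext <;> simp⟩, ⟨0, by ext <;> simp⟩⟩,
      fun z hz => ?_⟩, hEF⟩
  · obtain ⟨x, hx, y, hy, rfl⟩ := hEF z
    exact ⟨y, hy, x, hx, add_comm x y⟩
  · exact eq_zero_of_orthogonal_of_spanning hEF (fun x hx => hE x hx z hz.1)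
      fun x hx => hF x hx z hz.2
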